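/- arXiv:2108.07675 — 8 statements merged into one kernel-verified Lean document; each statement's English description precedes it below -/
import Mathlib

section
/- Let k and p be positive integers with k ≤ p, let v ≥ k, and let m_1, …, m_v be positive integers with ∑_{i=1}^v m_i ≤ p. Then ∑_{i=1}^v 1/m_i ≥ F(k, p). (This is the core of Lemma 2 of the paper: under zero-forcing precoding, the communication latency when users decode is at least (u log₂(q)/ν)·F(k,p) for any coding scheme resulting in p computed products, since at least k distinct products with spatial diversities m_i must be collected and the diversities sum to at most p.) -/
/-- `F(k, p)` from Lemma 2: `k²/p` if `k ∣ p`, and otherwise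
`(⌈p/k⌉·k − p)/⌊p/k⌋ + (p − k·⌊p/k⌋)/⌈p/k⌉`. -/
noncomputable def commLatencyBound (k p : ℕ) : ℝ :=
  if k ∣ p then (k : ℝ) ^ 2 / p
  else ((⌈(p : ℝ) / k⌉ : ℤ) * k - p) / ((⌊(p : ℝ) / k⌋ : ℤ) : ℝ)
    + ((p : ℝ) - k * ((⌊(p : ℝ) / k⌋ : ℤ) : ℝ)) / ((⌈(p : ℝ) / k⌉ : ℤ) : ℝ)

/-- Chord bound for `x ↦ 1 / x` between the consecutive integers `q` and `q + 1`,
valid at every positive integer. -/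
lemma chord_le_one_div_natCast {q n : ℕ} (hq : 0 < q) (hn : 0 < n) :
    (2 * q + 1 - n : ℝ) / (q * (q + 1)) ≤ 1 / n := by
  have hq' : (0 : ℝ) < q := by exact_mod_cast hq
  have hn' : (0 : ℝ) < n := by exact_mod_cast hn
  have h : (0 : ℝ) ≤ ((n : ℝ) - q) * (n - q - 1) := by
    rcases le_or_gt n q with hle | hlt
    · have hle' : (n : ℝ) ≤ q := by exact_mod_cast hle
      exact mul_nonneg_of_nonpos_of_nonpos (by linarith) (by linarith)
    · have hlt' : (q : ℝ) + 1 ≤ n := by exact_mod_cast hlt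
      exact mul_nonneg (by linarith) (by linarith)
  rw [div_le_div_iff₀ (by positivity) hn']
  linarith

/-- Both branches of `commLatencyBound` agree with the chord bound at `q = p / k`. -/
lemma commLatencyBound_eq {k p : ℕ} (hk : 0 < k) (hkp : k ≤ p) :
    commLatencyBound k p =
      ((k : ℝ) * (2 * (p / k : ℕ) + 1) - p) / ((p / k : ℕ) * ((p / k : ℕ) + 1)) := by
  have hk' : (0 : ℝ) < k := by exact_mod_cast hk
  have hq : 0 < p / k := Nat.div_pos hkp hk
  have hlow : k * (p / k) ≤ p := Nat.mul_div_le p k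
  have hhigh : p < k * (p / k + 1) := Nat.lt_mul_div_succ p hk
  have hdvd : k ∣ p ↔ k * (p / k) = p :=
    ⟨Nat.mul_div_cancel', fun h => ⟨p / k, h.symm⟩⟩
  generalize p / k = q at *
  have hq' : (0 : ℝ) < q := by exact_mod_cast hq
  unfold commLatencyBound
  split_ifs with h
  · obtain rfl := hdvd.1 h
    push_cast
    field_simp
    ring
  · have hlow' : (k : ℝ) * q < p := by
      exact_mod_cast lt_of_le_of_ne hlow (mt hdvd.2 h)
    have hhigh' : (p : ℝ) < k * (q + 1) := by exact_mod_cast hhigh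
    have hfloor : ⌊(p : ℝ) / k⌋ = (q : ℤ) := by
      rw [Int.floor_eq_iff, le_div_iff₀ hk', div_lt_iff₀ hk']
      push_cast
      constructor <;> linarith
    have hceil : ⌈(p : ℝ) / k⌉ = (q : ℤ) + 1 := by
      rw [Int.ceil_eq_iff, lt_div_iff₀ hk', div_le_iff₀ hk']
      push_cast
      constructor <;> linarith
    rw [hfloor, hceil]
    push_cast
    field_simp
    ring

/-- **Core of Lemma 2.** If `v ≥ k` products with positive spatial diversities
`m₁, …, m_v` summing to at most `p` are collected, then
`∑ 1/mᵢ ≥ F(k, p)`. -/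
theorem sum_inv_diversity_ge
    (k p : ℕ) (hk : 0 < k) (hp : 0 < p) (hkp : k ≤ p)
    (v : ℕ) (hv : k ≤ v) (m : Fin v → ℕ) (hm : ∀ i, 0 < m i)
    (hsum : ∑ i, m i ≤ p) :
    (∑ i, (1 : ℝ) / (m i : ℝ)) ≥ commLatencyBound k p := by
  have hq : 0 < p / k := Nat.div_pos hkp hk
  rw [ge_iff_le, commLatencyBound_eq hk hkp]
  generalize p / k = q at *
  have hv' : (k : ℝ) ≤ v := by exact_mod_cast hv
  have hsum' : (∑ i, (m i : ℝ)) ≤ p := by exact_mod_cast hsum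
  calc ((k : ℝ) * (2 * q + 1) - p) / (q * (q + 1))
      ≤ (v * (2 * q + 1) - ∑ i, (m i : ℝ)) / (q * (q + 1)) := by gcongr
    _ = ∑ i, (2 * q + 1 - m i : ℝ) / (q * (q + 1)) := by
        rw [← Finset.sum_div, Finset.sum_sub_distrib]
        simp [mul_add]
    _ ≤ ∑ i, (1 : ℝ) / m i :=
        Finset.sum_le_sum fun i _ => chord_le_one_div_natCast hq (hm i)
end

section
/- Let v ≥ 1 and let m_1, …, m_v be positive integers with sum S = ∑_{i=1}^v m_i, and let c = ⌊S/v⌋. If v does not divide S, then ∑_{i=1}^v 1/m_i ≥ ((c+1)·v − S)/c + (S − c·v)/(c+1). (Non-integer-mean case of the proof of Lemma 2: the minimum of ∑ 1/m_i subject to ∑ m_i = S is attained by giving (⌈m̄⌉ − m̄)v products diversity ⌊m̄⌋ and (m̄ − ⌊m̄⌋)v products diversity ⌈m̄⌉, where m̄ = S/v.) -/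
/-- The reciprocal of a positive integer lies above the secant line of `x ↦ 1 / x` through the
consecutive integers `c` and `c + 1`. -/
theorem secant_le_one_div_natCast {c n : ℕ} (hc : 0 < c) (hn : 0 < n) :
    ((c : ℝ) + 1 - n) / c + ((n : ℝ) - c) / ((c : ℝ) + 1) ≤ 1 / (n : ℝ) := by
  have hc' : (0 : ℝ) < c := by exact_mod_cast hc
  have hn' : (0 : ℝ) < n := by exact_mod_cast hn
  have key : (0 : ℝ) ≤ ((n : ℝ) - c) * ((n : ℝ) - c - 1) := by
    rcases Nat.lt_or_ge c n with h | h
    · have h' : (c : ℝ) + 1 ≤ n := by exact_mod_cast h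
      exact mul_nonneg (by linarith) (by linarith)
    · have h' : (n : ℝ) ≤ c := by exact_mod_cast h
      exact mul_nonneg_of_nonpos_of_nonpos (by linarith) (by linarith)
  rw [← sub_nonneg]
  have gap : 1 / (n : ℝ) - (((c : ℝ) + 1 - n) / c + ((n : ℝ) - c) / ((c : ℝ) + 1)) =
      ((n : ℝ) - c) * ((n : ℝ) - c - 1) / (n * c * (c + 1)) := by
    field_simp
    ring
  rw [gap]
  positivity

/-- **Non-integer-mean case of the proof of Lemma 2.** If `v ≥ 1` products have
positive spatial diversities `m₁, …, m_v` with sum `S = ∑ mᵢ` not divisible by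
`v`, and `c = ⌊S/v⌋`, then `∑ 1/mᵢ ≥ ((c+1)·v − S)/c + (S − c·v)/(c+1)`. -/
theorem sum_inv_diversity_ge_of_noninteger_mean
    (v : ℕ) (hv : 1 ≤ v) (m : Fin v → ℕ) (hm : ∀ i, 0 < m i)
    (S c : ℕ) (hS : S = ∑ i, m i) (hc : c = S / v) (hnd : ¬ v ∣ S) :
    (∑ i, (1 : ℝ) / (m i : ℝ)) ≥
      (((c : ℝ) + 1) * v - S) / c + ((S : ℝ) - c * v) / ((c : ℝ) + 1) := by
  have hvS : v ≤ S := by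
    rw [hS]
    simpa using Finset.card_nsmul_le_sum Finset.univ m 1 fun i _ => hm i
  have hc0 : 0 < c := hc ▸ Nat.div_pos hvS hv
  calc (((c : ℝ) + 1) * v - S) / c + ((S : ℝ) - c * v) / ((c : ℝ) + 1)
      = ∑ i, (((c : ℝ) + 1 - m i) / c + ((m i : ℝ) - c) / ((c : ℝ) + 1)) := by
        rw [Finset.sum_add_distrib, ← Finset.sum_div, ← Finset.sum_div,
          Finset.sum_sub_distrib, Finset.sum_sub_distrib, hS]
        simp [mul_comm, mul_add]
    _ ≤ ∑ i, (1 : ℝ) / (m i : ℝ) :=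
        Finset.sum_le_sum fun i _ => secant_le_one_div_natCast hc0 (hm i)
end

section
/- Let e ≥ 1, let v_1, …, v_e be nonnegative real numbers, set V = ∑_{m=1}^e v_m and S = ∑_{m=1}^e m·v_m, and let c be a positive integer. Then both ∑_{m=1}^e v_m/m − V/c ≥ (cV − S)/(c(c+1)) and ∑_{m=1}^e v_m/m − V/(c+1) ≥ ((c+1)V − S)/(c(c+1)) hold. (Intermediate inequalities in the proof of Lemma 2, non-integer-mean case, applied to the two parts A and B of the partition of the set of distinct products, with c = ⌊m̄⌋.) -/
/-- The convex function `1 / m` lies above its secant through the consecutive integers `c`, `c + 1`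
at every positive integer `m`. -/
theorem secant_le_inv_natCast {m c : ℕ} (hm : 0 < m) (hc : 0 < c) :
    (2 * (c : ℝ) + 1 - m) / ((c : ℝ) * ((c : ℝ) + 1)) ≤ (m : ℝ)⁻¹ := by
  have hm' : (0 : ℝ) < m := by exact_mod_cast hm
  have hc' : (0 : ℝ) < c := by exact_mod_cast hc
  have key : 0 ≤ ((m : ℝ) - c) * ((m : ℝ) - c - 1) := by
    rcases Nat.lt_or_ge c m with h | h
    · have h' : (c : ℝ) + 1 ≤ m := by exact_mod_cast h
      exact mul_nonneg (by linarith) (by linarith)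
    · have h' : (m : ℝ) ≤ c := by exact_mod_cast h
      exact mul_nonneg_of_nonpos_of_nonpos (by linarith) (by linarith)
  rw [inv_eq_one_div, div_le_div_iff₀ (by positivity) hm']
  linarith

/-- The secant bound for `1 / m`, summed against nonnegative weights. -/
theorem secant_le_sum_div {s : Finset ℕ} {v : ℕ → ℝ} (hs : ∀ m ∈ s, 0 < m)
    (hv : ∀ m ∈ s, 0 ≤ v m) {c : ℕ} (hc : 0 < c) :
    ((2 * (c : ℝ) + 1) * ∑ m ∈ s, v m - ∑ m ∈ s, (m : ℝ) * v m) / ((c : ℝ) * ((c : ℝ) + 1)) ≤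
      ∑ m ∈ s, v m / (m : ℝ) := by
  rw [Finset.mul_sum, ← Finset.sum_sub_distrib, Finset.sum_div]
  refine Finset.sum_le_sum fun m hm => ?_
  calc ((2 * (c : ℝ) + 1) * v m - m * v m) / ((c : ℝ) * ((c : ℝ) + 1))
      = v m * ((2 * (c : ℝ) + 1 - m) / ((c : ℝ) * ((c : ℝ) + 1))) := by ring
    _ ≤ v m * (m : ℝ)⁻¹ :=
        mul_le_mul_of_nonneg_left (secant_le_inv_natCast (hs m hm) hc) (hv m hm)
    _ = v m / m := (div_eq_mul_inv _ _).symm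

/-- **Intermediate inequalities in the proof of Lemma 2 (non-integer-mean
case).** For nonnegative reals `v₁, …, v_e` with `V = ∑ v_m`, `S = ∑ m·v_m`,
and a positive integer `c`, both
`∑ v_m/m − V/c ≥ (cV − S)/(c(c+1))` and
`∑ v_m/m − V/(c+1) ≥ ((c+1)V − S)/(c(c+1))` hold. -/
theorem sum_div_sub_ge_noninteger_mean
    (e : ℕ) (he : 1 ≤ e) (v : ℕ → ℝ) (hv : ∀ m ∈ Finset.Icc 1 e, 0 ≤ v m)
    (V S : ℝ) (hV : V = ∑ m ∈ Finset.Icc 1 e, v m)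
    (hS : S = ∑ m ∈ Finset.Icc 1 e, (m : ℝ) * v m)
    (c : ℕ) (hc : 0 < c) :
    (∑ m ∈ Finset.Icc 1 e, v m / (m : ℝ)) - V / (c : ℝ) ≥
        ((c : ℝ) * V - S) / ((c : ℝ) * ((c : ℝ) + 1)) ∧
    (∑ m ∈ Finset.Icc 1 e, v m / (m : ℝ)) - V / ((c : ℝ) + 1) ≥
        (((c : ℝ) + 1) * V - S) / ((c : ℝ) * ((c : ℝ) + 1)) := by
  have hc' : (0 : ℝ) < c := by exact_mod_cast hc
  have key := secant_le_sum_div (fun m hm => (Finset.mem_Icc.mp hm).1) hv hc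
  rw [← hV, ← hS] at key
  have h₁ : V / (c : ℝ) + ((c : ℝ) * V - S) / ((c : ℝ) * ((c : ℝ) + 1)) =
      ((2 * (c : ℝ) + 1) * V - S) / ((c : ℝ) * ((c : ℝ) + 1)) := by
    field_simp
    ring
  have h₂ : V / ((c : ℝ) + 1) + (((c : ℝ) + 1) * V - S) / ((c : ℝ) * ((c : ℝ) + 1)) =
      ((2 * (c : ℝ) + 1) * V - S) / ((c : ℝ) * ((c : ℝ) + 1)) := by
    field_simp
    ring
  constructor <;> linarith
end

section
/- Let e, k ≥ 1 be natural numbers, λ : Fin e → ℝ, δ > 0, 0 < s ≤ S real storage caps, and a ≥ 0 a real number. Suppose t ≥ 0 and p ∈ ℕ with p ≥ k satisfy ∑_{j=1}^e min(⌊(t − λ_j)^+/δ⌋, s) = p, and let M be a positive integer with M ≤ e. Then t + a/M ≥ inf{ t' ≥ 0 : ∑_{j=1}^e min(⌊(t' − λ_j)^+/δ⌋, S) ≥ k } + a/e. (This is the deterministic core of Theorem 2 of the paper: for any coding scheme and any realization of the straggling times, when the edge nodes decode, the sum of computation latency and downlink communication latency is at least L̄_c(λ, k) + u·k·log₂(q)/(ν·e);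 taking expectations over λ yields the stated bound on τ_e.) -/
/-- **Deterministic core of Theorem 2 (edge nodes decode).** If at time `t` the
`e` edge servers with straggling times `lam`, per-product time `δ` and
per-server cap `s ≤ S` have computed exactly `p ≥ k` products, and the `M ≤ e`
non-straggling edge nodes transmit at downlink latency `a/M`, then
`t + a/M ≥ L̄_c(λ, k) + a/e`. -/
theorem total_latency_lower_bound_edge_decode
    (e k : ℕ) (he : 1 ≤ e) (hk : 1 ≤ k)
    (lam : Fin e → ℝ) (δ : ℝ) (hδ : 0 < δ)
    (s S : ℝ) (hs : 0 < s) (hsS : s ≤ S)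
    (a : ℝ) (ha : 0 ≤ a)
    (t : ℝ) (ht : 0 ≤ t) (p : ℕ) (hpk : k ≤ p)
    (hp : ∑ j : Fin e, min ((⌊(max (t - lam j) 0) / δ⌋ : ℤ) : ℝ) s = (p : ℝ))
    (M : ℕ) (hM : 0 < M) (hMe : M ≤ e) :
    t + a / (M : ℝ) ≥
      sInf {t' : ℝ | 0 ≤ t' ∧
          (k : ℝ) ≤ ∑ j : Fin e, min ((⌊(max (t' - lam j) 0) / δ⌋ : ℤ) : ℝ) S}
        + a / (e : ℝ) := by
  have hdown : a / (e : ℝ) ≤ a / (M : ℝ) := by gcongr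
  have hcomp : sInf {t' : ℝ | 0 ≤ t' ∧
      (k : ℝ) ≤ ∑ j : Fin e, min ((⌊(max (t' - lam j) 0) / δ⌋ : ℤ) : ℝ) S} ≤ t := by
    refine csInf_le ⟨0, fun _ h => h.1⟩ ⟨ht, ?_⟩
    calc (k : ℝ) ≤ p := by exact_mod_cast hpk
      _ = ∑ j : Fin e, min ((⌊(max (t - lam j) 0) / δ⌋ : ℤ) : ℝ) s := hp.symm
      _ ≤ _ := Finset.sum_le_sum fun _ _ => min_le_min_left _ hsS
  linarith
end

section
/- Let a, b, a₁, a₂, b₁, b₂ be positive real numbers. (i) If b ≤ a₁ ≤ a₂, then f(a₂, b) ≤ f(a₁, b), i.e., f(a, b) is monotonically decreasing in a on [b, ∞). (ii) If b₁ ≤ b₂ ≤ a, then f(a, b₁) ≤ f(a, b₂), i.e., f(a, b) is monotonically increasing in b on (0, a]. (This is Lemma 4 of the paper.) -/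
open Classical in
/-- The function `f(a, b)` of Lemma 4: `b²/a` if `a/b` is a natural number, and
`(⌈a/b⌉·b − a)/⌊a/b⌋ + (a − b·⌊a/b⌋)/⌈a/b⌉` otherwise. -/
noncomputable def lemma4f (a b : ℝ) : ℝ :=
  if ∃ n : ℕ, a / b = (n : ℝ) then b ^ 2 / a
  else ((⌈a / b⌉ : ℤ) * b - a) / ((⌊a / b⌋ : ℤ) : ℝ)
    + (a - b * ((⌊a / b⌋ : ℤ) : ℝ)) / ((⌈a / b⌉ : ℤ) : ℝ)

/-- The line through `(m, 1 / m)` and `(m + 1, 1 / (m + 1))`, homogenized: for `x = a / b` its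
value at `x`, multiplied by `b`. -/
noncomputable def chord (a b : ℝ) (m : ℤ) : ℝ :=
  ((2 * m + 1) * b - a) / (m * (m + 1))

theorem chord_le_chord {a a' b b' : ℝ} {m : ℤ} (hm : 1 ≤ m) (ha : a' ≤ a) (hb : b ≤ b') :
    chord a b m ≤ chord a' b' m := by
  have hm' : (1 : ℝ) ≤ m := by exact_mod_cast hm
  unfold chord
  gcongr

theorem chord_int_one_le {m n : ℤ} (hm : 1 ≤ m) (hn : 1 ≤ n) : chord n 1 m ≤ 1 / n := by
  have hm' : (1 : ℝ) ≤ m := by exact_mod_cast hm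
  have hn' : (1 : ℝ) ≤ n := by exact_mod_cast hn
  have h : (0 : ℤ) ≤ (n - m) * (n - m - 1) := by
    rcases le_or_gt n m with h | h
    · exact mul_nonneg_of_nonpos_of_nonpos (by omega) (by omega)
    · exact mul_nonneg (by omega) (by omega)
  have h' : (0 : ℝ) ≤ (n - m) * (n - m - 1) := by exact_mod_cast h
  unfold chord
  rw [div_le_div_iff₀ (by positivity) (by positivity)]
  linarith

theorem chord_eq_interpolation {k : ℤ} (hk : 1 ≤ k) (a b : ℝ) :
    chord a b k = ((k + 1) * b - a) * (1 / k) + (a - k * b) * (1 / (k + 1)) := by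
  have hk' : (1 : ℝ) ≤ k := by exact_mod_cast hk
  have : (k : ℝ) ≠ 0 := by positivity
  have : (k : ℝ) + 1 ≠ 0 := by positivity
  unfold chord
  field_simp
  ring

theorem chord_le_chord_of_mem_Icc {a b : ℝ} {m k : ℤ} (hm : 1 ≤ m) (hk : 1 ≤ k)
    (hl : k * b ≤ a) (hu : a ≤ (k + 1) * b) : chord a b m ≤ chord a b k := by
  have h₁ := chord_int_one_le hm hk
  have h₂ := chord_int_one_le (n := k + 1) hm (by omega)
  push_cast at h₂
  have h : chord a b m =
      ((k + 1) * b - a) * chord k 1 m + (a - k * b) * chord (k + 1) 1 m := by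
    unfold chord
    ring
  rw [h, chord_eq_interpolation hk]
  exact add_le_add (mul_le_mul_of_nonneg_left h₁ (by linarith))
    (mul_le_mul_of_nonneg_left h₂ (by linarith))

theorem one_le_floor_div {a b : ℝ} (hb : 0 < b) (hab : b ≤ a) : 1 ≤ ⌊a / b⌋ :=
  Int.le_floor.2 (by simpa using (one_le_div hb).2 hab)

theorem lemma4f_eq_chord_floor {a b : ℝ} (hb : 0 < b) (hab : b ≤ a) :
    lemma4f a b = chord a b ⌊a / b⌋ := by
  have hk := one_le_floor_div hb hab
  unfold lemma4f
  split_ifs with h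
  · obtain ⟨n, hn⟩ := h
    have ha : a = n * b := (div_eq_iff hb.ne').1 hn
    have hn0 : (n : ℝ) ≠ 0 := by
      rintro h0
      rw [h0, zero_mul] at ha
      linarith
    have : (n : ℝ) + 1 ≠ 0 := by positivity
    rw [hn, Int.floor_natCast, chord, ha, Int.cast_natCast]
    field_simp
    ring
  · have hc : ⌈a / b⌉ = ⌊a / b⌋ + 1 := by
      rw [Int.ceil_eq_iff]
      push_cast
      refine ⟨?_, (Int.lt_floor_add_one _).le⟩
      rw [add_sub_cancel_right]
      refine lt_of_le_of_ne (Int.floor_le _) fun he => h ⟨⌊a / b⌋.toNat, ?_⟩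
      rw [← he, Int.floor_intCast]
      exact_mod_cast (Int.toNat_of_nonneg (by omega)).symm
    rw [hc, chord_eq_interpolation hk]
    push_cast
    ring

theorem chord_le_lemma4f {a b : ℝ} {m : ℤ} (hm : 1 ≤ m) (hb : 0 < b) (hab : b ≤ a) :
    chord a b m ≤ lemma4f a b := by
  rw [lemma4f_eq_chord_floor hb hab]
  exact chord_le_chord_of_mem_Icc hm (one_le_floor_div hb hab)
    ((le_div_iff₀ hb).1 (Int.floor_le _)) ((div_le_iff₀ hb).1 (Int.lt_floor_add_one _).le)

theorem lemma4f_le_lemma4f {a a' b b' : ℝ} (hb : 0 < b) (hbb : b ≤ b') (hba : b' ≤ a')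
    (haa : a' ≤ a) : lemma4f a b ≤ lemma4f a' b' := by
  have hab : b ≤ a := hbb.trans (hba.trans haa)
  have hk := one_le_floor_div hb hab
  rw [lemma4f_eq_chord_floor hb hab]
  exact (chord_le_chord hk haa hbb).trans (chord_le_lemma4f hk (hb.trans_le hbb) hba)


/-- **Lemma 4.** `f(a, b)` is monotonically decreasing in `a` on `[b, ∞)` and
monotonically increasing in `b` on `(0, a]`. -/
theorem lemma4f_monotone
    (a b a₁ a₂ b₁ b₂ : ℝ) (ha : 0 < a) (hb : 0 < b)
    (ha₁ : 0 < a₁) (ha₂ : 0 < a₂) (hb₁ : 0 < b₁) (hb₂ : 0 < b₂) :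
    (b ≤ a₁ → a₁ ≤ a₂ → lemma4f a₂ b ≤ lemma4f a₁ b) ∧
    (b₁ ≤ b₂ → b₂ ≤ a → lemma4f a b₁ ≤ lemma4f a b₂) := by
  exact ⟨fun h₁ h₂ => lemma4f_le_lemma4f hb le_rfl h₁ h₂,
    fun h₁ h₂ => lemma4f_le_lemma4f hb₁ h₁ h₂ le_rfl⟩
end

section
/- Let a > 0 be a real number and d a positive integer, and set b₁ = a/(d+1) and b₂ = a/d. Then for every real b with b₁ ≤ b ≤ b₂, one has f(a, b) = (b₁²/a)·(1 − β) + (b₂²/a)·β, where β = (b − b₁)/(b₂ − b₁). In particular, on the interval [a/(d+1), a/d] the function b ↦ f(a, b) is the convex combination of the endpoint values b₁²/a = a/(d+1)² and b₂²/a = a/d². (Identity established in the proof of Lemma 4 to show monotone increase in b.) -/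
/-- **Convex-combination identity in `b` from the proof of Lemma 4.** For
`a > 0` and a positive integer `d`, with `b₁ = a/(d+1)` and `b₂ = a/d`, on the
interval `[b₁, b₂]` one has
`f(a, b) = (b₁²/a)·(1 − β) + (b₂²/a)·β` with `β = (b − b₁)/(b₂ − b₁)`. -/
theorem lemma4f_convex_combination_in_b
    (a : ℝ) (ha : 0 < a) (d : ℕ) (hd : 0 < d) :
    ∀ b : ℝ, a / ((d : ℝ) + 1) ≤ b → b ≤ a / (d : ℝ) →
      lemma4f a b = ((a / ((d : ℝ) + 1)) ^ 2 / a)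
          * (1 - (b - a / ((d : ℝ) + 1)) / (a / (d : ℝ) - a / ((d : ℝ) + 1)))
        + ((a / (d : ℝ)) ^ 2 / a)
          * ((b - a / ((d : ℝ) + 1)) / (a / (d : ℝ) - a / ((d : ℝ) + 1))) := by
  intro b hb₁ hb₂
  have hd' : (0 : ℝ) < d := by exact_mod_cast hd
  have hd₁ : (0 : ℝ) < (d : ℝ) + 1 := by positivity
  have hb : 0 < b := (div_pos ha hd₁).trans_le hb₁
  have hgap : a / (d : ℝ) - a / ((d : ℝ) + 1) = a / (d * (d + 1)) := by
    field_simp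
    ring
  rw [hgap]
  rcases hb₁.eq_or_lt with rfl | hlt₁
  · have hnat : ∃ n : ℕ, a / (a / ((d : ℝ) + 1)) = (n : ℝ) :=
      ⟨d + 1, by push_cast; field_simp⟩
    rw [lemma4f, if_pos hnat]
    simp
  rcases hb₂.eq_or_lt with rfl | hlt₂
  · have hnat : ∃ n : ℕ, a / (a / (d : ℝ)) = (n : ℝ) := ⟨d, by field_simp⟩
    rw [lemma4f, if_pos hnat]
    field_simp
    ring
  have hlo : (d : ℝ) < a / b := (lt_div_comm₀ hb hd').mp hlt₂
  have hhi : a / b < (d : ℝ) + 1 := (div_lt_comm₀ hd₁ hb).mp hlt₁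
  have hnat : ¬ ∃ n : ℕ, a / b = (n : ℝ) := by
    rintro ⟨n, hn⟩
    rw [hn] at hlo hhi
    norm_cast at hlo hhi
    omega
  have hfloor : ⌊a / b⌋ = (d : ℤ) := by
    rw [Int.floor_eq_iff]
    exact ⟨by exact_mod_cast hlo.le, by exact_mod_cast hhi⟩
  have hceil : ⌈a / b⌉ = (d : ℤ) + 1 := by
    rw [Int.ceil_eq_iff]
    push_cast
    exact ⟨by linarith, hhi.le⟩
  rw [lemma4f, if_neg hnat, hfloor, hceil]
  push_cast
  field_simp
  ring
end

section
/- For every fixed real b > 0, the function a ↦ f(a, b) is continuous on the interval [b, ∞). (Continuity claim established in the proof of Lemma 4: the first case expression b²/a fills in the points a = c·b, c ∈ ℕ, at which the second case expression is discontinuous, making f continuous in a.) -/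
/-- On `[n * b, (n + 1) * b]` the function `a ↦ lemma4f a b` is affine. -/
theorem lemma4f_eq_of_mem_Icc {b : ℝ} (hb : 0 < b) {n : ℕ} (hn : 1 ≤ n) {a : ℝ}
    (ha : a ∈ Set.Icc (n * b) ((n + 1) * b)) :
    lemma4f a b = ((n + 1) * b - a) / n + (a - b * n) / (n + 1) := by
  have hn0 : (0 : ℝ) < n := by exact_mod_cast hn
  have hn1 : (0 : ℝ) < (n : ℝ) + 1 := by linarith
  obtain ⟨h1, h2⟩ := ha
  rcases h1.eq_or_lt with rfl | h1
  · rw [lemma4f, if_pos ⟨n, by field_simp⟩]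
    field_simp
    ring
  rcases h2.eq_or_lt with rfl | h2
  · rw [lemma4f, if_pos ⟨n + 1, by push_cast; field_simp⟩]
    field_simp
    ring
  have h3 : (n : ℝ) < a / b := (lt_div_iff₀ hb).2 h1
  have h4 : a / b < n + 1 := (div_lt_iff₀ hb).2 h2
  have hfloor : ⌊a / b⌋ = (n : ℤ) := by
    rw [Int.floor_eq_iff]
    push_cast
    exact ⟨h3.le, h4⟩
  have hceil : ⌈a / b⌉ = (n : ℤ) + 1 := by
    rw [Int.ceil_eq_iff]
    push_cast
    exact ⟨by linarith, h4.le⟩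
  have hnot : ¬ ∃ m : ℕ, a / b = (m : ℝ) := by
    rintro ⟨m, hm⟩
    rw [hm] at h3 h4
    have h5 : n < m := by exact_mod_cast h3
    have h6 : m < n + 1 := by exact_mod_cast h4
    omega
  rw [lemma4f, if_neg hnot, hfloor, hceil]
  push_cast
  ring

theorem lemma4f_continuousOn_Icc {b : ℝ} (hb : 0 < b) (n : ℕ) :
    ContinuousOn (fun a : ℝ => lemma4f a b) (Set.Icc b ((n + 1) * b)) := by
  induction n with
  | zero => simp
  | succ n ih =>
    have hle : b ≤ (n + 1) * b := by nlinarith [n.cast_nonneg (α := ℝ)]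
    have hle' : (n + 1) * b ≤ (n + 1 + 1) * b := by nlinarith
    push_cast
    rw [← Set.Icc_union_Icc_eq_Icc hle hle']
    refine ih.union_of_isClosed ?_ isClosed_Icc isClosed_Icc
    have hcont : Continuous fun a : ℝ =>
        (((n + 1 : ℕ) + 1) * b - a) / (n + 1 : ℕ) + (a - b * (n + 1 : ℕ)) / ((n + 1 : ℕ) + 1) := by
      fun_prop
    refine hcont.continuousOn.congr fun a ha => ?_
    exact lemma4f_eq_of_mem_Icc hb n.succ_pos (by push_cast; exact ha)

/-- **Continuity in `a` from the proof of Lemma 4.** For fixed `b > 0`, the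
function `a ↦ f(a, b)` is continuous on `[b, ∞)`. -/
theorem lemma4f_continuousOn_in_a (b : ℝ) (hb : 0 < b) :
    ContinuousOn (fun a : ℝ => lemma4f a b) (Set.Ici b) := by
  intro x hx
  obtain ⟨n, hn⟩ := exists_nat_gt (x / b)
  have hxn : x < (n + 1) * b := by
    rw [div_lt_iff₀ hb] at hn
    linarith
  refine (lemma4f_continuousOn_Icc hb n x ⟨hx, hxn.le⟩).mono_of_mem_nhdsWithin ?_
  filter_upwards [self_mem_nhdsWithin, mem_nhdsWithin_of_mem_nhds (Iio_mem_nhds hxn)] with y hy hy'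
  exact ⟨hy, le_of_lt hy'⟩
end

section
/- For every fixed real a > 0, the function b ↦ f(a, b) is continuous on the interval (0, a]. (Continuity claim established in the proof of Lemma 4: the interval (0, a] is the concatenation of the intervals [a/(d+1), a/d] for d = 1, 2, …, on each of which f(a, ·) is a continuous convex combination of the endpoint values, and the first case expression b²/a fills in the endpoints.) -/
/-- On `[a / (d + 1), a / d]`, the function `lemma4f a` is affine. -/
theorem lemma4f_eq_affine {a b : ℝ} {d : ℕ} (ha : 0 < a) (hd : 0 < d)
    (hb : b ∈ Set.Icc (a / (d + 1 : ℝ)) (a / d)) :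
    lemma4f a b = ((d + 1) * b - a) / d + (a - b * d) / (d + 1) := by
  have hd' : (0 : ℝ) < d := by exact_mod_cast hd
  have hb0 : 0 < b := lt_of_lt_of_le (by positivity) hb.1
  rcases hb.1.eq_or_lt with rfl | hlt
  · rw [lemma4f, if_pos ⟨d + 1, by push_cast; field_simp⟩]
    field_simp
    ring
  rcases hb.2.eq_or_lt with rfl | hgt
  · rw [lemma4f, if_pos ⟨d, by field_simp⟩]
    field_simp
    ring
  have h_lower : (d : ℝ) < a / b := by
    rw [lt_div_iff₀ hd'] at hgt
    rw [lt_div_iff₀ hb0]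
    linarith
  have h_upper : a / b < d + 1 := by
    rw [div_lt_iff₀ (by positivity)] at hlt
    rw [div_lt_iff₀ hb0]
    linarith
  have h_floor : ⌊a / b⌋ = (d : ℤ) := by
    rw [Int.floor_eq_iff]
    push_cast
    exact ⟨h_lower.le, h_upper⟩
  have h_ceil : ⌈a / b⌉ = (d + 1 : ℤ) := by
    rw [Int.ceil_eq_iff]
    push_cast
    exact ⟨by linarith, h_upper.le⟩
  have h_not_nat : ¬ ∃ n : ℕ, a / b = (n : ℝ) := by
    rintro ⟨n, hn⟩
    rw [hn] at h_lower h_upper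
    norm_cast at h_lower h_upper
    omega
  rw [lemma4f, if_neg h_not_nat, h_floor, h_ceil]
  push_cast
  ring

theorem lemma4f_continuousOn_Icc_s13 {a : ℝ} (ha : 0 < a) (n : ℕ) :
    ContinuousOn (lemma4f a) (Set.Icc (a / (n + 1 : ℝ)) a) := by
  induction n with
  | zero => simp
  | succ n ih =>
    have h_piece : ContinuousOn (lemma4f a)
        (Set.Icc (a / ((n + 1 : ℕ) + 1 : ℝ)) (a / (n + 1 : ℕ))) :=
      ContinuousOn.congr (by fun_prop) fun b hb => lemma4f_eq_affine ha n.succ_pos hb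
    have h_union := h_piece.union_of_isClosed (by exact_mod_cast ih) isClosed_Icc isClosed_Icc
    rwa [Set.Icc_union_Icc_eq_Icc] at h_union
    · gcongr
      linarith
    · exact div_le_self ha.le (by norm_cast; omega)

/-- **Continuity in `b` from the proof of Lemma 4.** For fixed `a > 0`, the
function `b ↦ f(a, b)` is continuous on `(0, a]`. -/
theorem lemma4f_continuousOn_in_b (a : ℝ) (ha : 0 < a) :
    ContinuousOn (fun b : ℝ => lemma4f a b) (Set.Ioc 0 a) := by
  intro b hb
  obtain ⟨n, hn⟩ := exists_nat_gt (a / b)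
  have h_lt : a / (n + 1 : ℝ) < b := by
    rw [div_lt_iff₀ hb.1] at hn
    rw [div_lt_iff₀ (by positivity)]
    linarith [hb.1]
  refine (lemma4f_continuousOn_Icc_s13 ha n b ⟨h_lt.le, hb.2⟩).mono_of_mem_nhdsWithin ?_
  filter_upwards [self_mem_nhdsWithin, mem_nhdsWithin_of_mem_nhds (Ioi_mem_nhds h_lt)]
    with c hc hc'
  exact ⟨le_of_lt hc', hc.2⟩
end
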